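/- arXiv:2411.01249 — 2 statements merged into one kernel-verified Lean document; each statement's English description precedes it below -/
import Mathlib

section
/- Exact fit property (uniqueness of the robust regression coefficient): Let N ≥ 1 and r ≥ 1 be integers, Λ an N×r real matrix with rows λ_1,…,λ_N satisfying the general-position condition, α ∈ ℝ^r, β ∈ ℝ^N, and D = β + Λα. Suppose the set C = {i : β_i = 0} has at least ⌊N/2⌋ + r elements. Then any α' ∈ ℝ^r for which the exact-fit set {i : D_i = λ_iᵀα'} has at least ⌊N/2⌋ + 1 elements must equal α. -/
open Finset

/-- Exact fit property: uniqueness of the robust regression coefficient. -/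
theorem exact_fit_uniqueness
    (N r : ℕ) (hN : 1 ≤ N) (hr : 1 ≤ r)
    (Λ : Fin N → Fin r → ℝ)
    (hGP : ∀ v : Fin r → ℝ, v ≠ 0 →
      {i : Fin N | (∑ j, Λ i j * v j) = 0}.ncard ≤ r - 1)
    (α : Fin r → ℝ) (β : Fin N → ℝ)
    (D : Fin N → ℝ) (hD : D = fun i => β i + ∑ j, Λ i j * α j)
    (hC : N / 2 + r ≤ {i : Fin N | β i = 0}.ncard) :
    ∀ α' : Fin r → ℝ,
      N / 2 + 1 ≤ {i : Fin N | D i = ∑ j, Λ i j * α' j}.ncard → α' = α := by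
  intro α' hα'
  by_contra hne
  have hsub : {i : Fin N | β i = 0} ∩ {i : Fin N | D i = ∑ j, Λ i j * α' j} ⊆
      {i : Fin N | (∑ j, Λ i j * (α' - α) j) = 0} := by
    rintro i ⟨hβ, hfit⟩
    simp only [Set.mem_ofPred_eq, hD] at hβ hfit
    simp only [Set.mem_ofPred_eq, Pi.sub_apply, mul_sub, Finset.sum_sub_distrib]
    linarith
  have hinter := (Set.ncard_le_ncard hsub (Set.toFinite _)).trans (hGP _ (sub_ne_zero.mpr hne))
  have hunion := Set.ncard_le_card
    ({i : Fin N | β i = 0} ∪ {i : Fin N | D i = ∑ j, Λ i j * α' j})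
  have hadd := Set.ncard_union_add_ncard_inter
    {i : Fin N | β i = 0} {i : Fin N | D i = ∑ j, Λ i j * α' j}
  rw [Nat.card_eq_fintype_card, Fintype.card_fin] at hunion
  omega
end

section
/- Identification of the average effects and factor mean shift: Let N ≥ 1 and r ≥ 1 be integers and Λ an N×r real matrix with rows λ_1,…,λ_N satisfying the general-position condition. Suppose β + Λα = β' + Λα' for vectors α, α' ∈ ℝ^r and β, β' ∈ ℝ^N such that both {i : β_i = 0} and {i : β'_i = 0} have at least ⌊N/2⌋ + r elements. Then α = α' and β = β'. -/
open Finset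

/-- Identification of the average effects and the factor mean shift. -/
theorem identification_effects_and_shift
    (N r : ℕ) (hN : 1 ≤ N) (hr : 1 ≤ r)
    (Λ : Fin N → Fin r → ℝ)
    (hGP : ∀ v : Fin r → ℝ, v ≠ 0 →
      {i : Fin N | (∑ j, Λ i j * v j) = 0}.ncard ≤ r - 1)
    (α α' : Fin r → ℝ) (β β' : Fin N → ℝ)
    (heq : ∀ i, β i + ∑ j, Λ i j * α j = β' i + ∑ j, Λ i j * α' j)
    (hβ : N / 2 + r ≤ {i : Fin N | β i = 0}.ncard)
    (hβ' : N / 2 + r ≤ {i : Fin N | β' i = 0}.ncard) :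
    α = α' ∧ β = β' := by
  have hα : α = α' := by
    by_contra hne
    have hker := hGP (α - α') (sub_ne_zero.mpr hne)
    have hsub : {i : Fin N | β i = 0} ∩ {i : Fin N | β' i = 0} ⊆
        {i : Fin N | (∑ j, Λ i j * (α - α') j) = 0} := by
      rintro i ⟨hi, hi'⟩
      simp only [Set.mem_ofPred_eq] at hi hi' ⊢
      have h := heq i
      simp only [Pi.sub_apply, mul_sub, Finset.sum_sub_distrib]
      linarith
    have hinter := Set.ncard_le_ncard hsub (Set.toFinite _)
    have hadd := Set.ncard_union_add_ncard_inter
      {i : Fin N | β i = 0} {i : Fin N | β' i = 0} (Set.toFinite _) (Set.toFinite _)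
    have hunion : ({i : Fin N | β i = 0} ∪ {i : Fin N | β' i = 0}).ncard ≤ N := by
      simpa using Set.ncard_le_card ({i : Fin N | β i = 0} ∪ {i : Fin N | β' i = 0})
    omega
  subst hα
  exact ⟨rfl, funext fun i => add_right_cancel (heq i)⟩
end
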